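/- Let K be a compact subset of ℝ^n and let σ : ℝ → ℝ be a continuous function that is not a polynomial. Then for every continuous function f : K → ℝ^m and every ε > 0, there exist a natural number k, a matrix W ∈ ℝ^{k×n}, a vector b ∈ ℝ^k, and a matrix C ∈ ℝ^{m×k} such that sup_{x ∈ K} ‖f(x) − C · σ(Wx + b)‖ < ε, where σ is applied elementwise to the vector Wx + b. -/

import Mathlib

open MeasureTheory Topology Filter

namespace UAT

/-- A ridge-type element `p(x) * g(l * u(x) + b)` of `C(X, ℝ)`. -/
noncomputable def rid {X : Type*} [TopologicalSpace X] (p u : C(X, ℝ)) (g : ℝ → ℝ) (hg : Continuous g)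
    (l b : ℝ) : C(X, ℝ) :=
  ⟨fun x => p x * g (l * u x + b), by fun_prop⟩

lemma continuous_rid {X : Type*} [TopologicalSpace X] (p u : C(X, ℝ)) (g : ℝ → ℝ)
    (hg : Continuous g) : Continuous (fun q : ℝ × ℝ => rid p u g hg q.1 q.2) := by
  apply ContinuousMap.continuous_of_continuous_uncurry
  change Continuous (fun q : (ℝ × ℝ) × X => p q.2 * g (q.1.1 * u q.2 + q.1.2))
  fun_prop

lemma poly_antideriv (p : Polynomial ℝ) : ∃ q : Polynomial ℝ, q.derivative = p := by
  induction p using Polynomial.induction_on' with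
  | add p q hp hq =>
    obtain ⟨a, rfl⟩ := hp
    obtain ⟨b, rfl⟩ := hq
    exact ⟨a + b, by simp⟩
  | monomial n a =>
    refine ⟨Polynomial.monomial (n + 1) (a / (n + 1)), ?_⟩
    rw [Polynomial.derivative_monomial]
    congr 1
    push_cast
    have : (n : ℝ) + 1 ≠ 0 := by positivity
    field_simp

lemma natDegree_le_of_derivative {q : Polynomial ℝ} {k : ℕ} (h : q.derivative.degree < k) :
    q.degree < (k + 1 : ℕ) := by
  rw [Polynomial.degree_lt_iff_coeff_zero] at h ⊢
  intro m hm
  obtain ⟨m, rfl⟩ : ∃ j, m = j + 1 := ⟨m - 1, by omega⟩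
  have := h m (by omega)
  rw [Polynomial.coeff_derivative] at this
  rcases mul_eq_zero.1 this with h | h
  · exact h
  · exact absurd h (by positivity)

lemma poly_of_iteratedDeriv (k : ℕ) : ∀ (g : ℝ → ℝ), ContDiff ℝ (⊤ : ℕ∞) g →
    (∀ t, iteratedDeriv k g t = 0) →
    ∃ p : Polynomial ℝ, p.degree < k ∧ ∀ t, g t = p.eval t := by
  induction k with
  | zero =>
    intro g _ h
    exact ⟨0, by simp, by simpa using h⟩
  | succ k ih =>
    intro g hg h
    have hg' : ContDiff ℝ (⊤ : ℕ∞) (deriv g) := (contDiff_infty_iff_deriv.1 hg).2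
    have hd : Differentiable ℝ g := (contDiff_infty_iff_deriv.1 hg).1
    obtain ⟨p, hp, hpe⟩ := ih (deriv g) hg' (by rwa [iteratedDeriv_succ'] at h)
    obtain ⟨q, hq⟩ := poly_antideriv p
    have hc : ∀ t, g t - q.eval t = g 0 - q.eval 0 := by
      intro t
      refine is_const_of_deriv_eq_zero (f := fun t => g t - q.eval t)
        (hd.sub q.differentiable) ?_ t 0
      intro s
      rw [deriv_fun_sub (hd s) q.differentiableAt, hpe, Polynomial.deriv, hq, sub_self]
    refine ⟨q + Polynomial.C (g 0 - q.eval 0), ?_, ?_⟩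
    · apply natDegree_le_of_derivative
      simpa [hq] using hp
    · intro t
      have := hc t
      simp
      linarith

lemma poly_of_limit (k : ℕ) (g : ℕ → ℝ → ℝ) (σ : ℝ → ℝ)
    (hg : ∀ i, ∃ p : Polynomial ℝ, p.degree < k ∧ ∀ t, g i t = p.eval t)
    (hlim : ∀ t, Tendsto (fun i => g i t) atTop (𝓝 (σ t))) :
    ∃ p : Polynomial ℝ, ∀ t, σ t = p.eval t := by
  refine ⟨Lagrange.interpolate (Finset.range k) (fun i : ℕ => (i : ℝ)) (fun i => σ i), ?_⟩
  intro t
  refine tendsto_nhds_unique (hlim t) ?_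
  have : ∀ i, g i t =
      (Lagrange.interpolate (Finset.range k) (fun i : ℕ => (i : ℝ)) (fun j => g i j)).eval t := by
    intro i
    obtain ⟨p, hp, hpe⟩ := hg i
    rw [← Lagrange.eq_interpolate_of_eval_eq (f := p), hpe]
    · exact fun a _ b _ h => Nat.cast_injective h
    · simpa using hp
    · intro j _
      exact (hpe j).symm
  simp_rw [this, Lagrange.interpolate_apply, Polynomial.eval_finsetSum, Polynomial.eval_mul,
    Polynomial.eval_C]
  exact tendsto_finsetSum _ fun j _ => (hlim j).mul_const _

section
variable {X : Type*} [TopologicalSpace X] [CompactSpace X]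

lemma deriv_mem (S : Submodule ℝ C(X, ℝ)) (hS : IsClosed (S : Set C(X, ℝ)))
    (p u : C(X, ℝ)) (g : ℝ → ℝ) (hg : Continuous g) (hd : Differentiable ℝ g)
    (hg' : Continuous (deriv g)) (h : ∀ l b, rid p u g hg l b ∈ S) (l b : ℝ) :
    rid (p * u) u (deriv g) hg' l b ∈ S := by
  have hcont : Continuous (fun s : ℝ => rid (p * u) u (deriv g) hg' s b) :=
    (continuous_rid (p * u) u (deriv g) hg').comp (by fun_prop : Continuous fun s : ℝ => (s, b))
  have hint : ∀ s, rid p u g hg s b = rid p u g hg 0 b +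
      ∫ r in (0 : ℝ)..s, rid (p * u) u (deriv g) hg' r b := by
    intro s
    ext x
    have h1 : (∫ r in (0 : ℝ)..s, rid (p * u) u (deriv g) hg' r b) x =
        ∫ r in (0 : ℝ)..s, (rid (p * u) u (deriv g) hg' r b) x :=
      ((ContinuousMap.evalCLM ℝ x).intervalIntegral_comp_comm
        (hcont.intervalIntegrable 0 s)).symm
    rw [ContinuousMap.add_apply, h1]
    have h2 : ∀ r ∈ Set.uIcc 0 s, HasDerivAt (fun r => (rid p u g hg r b) x)
        ((rid (p * u) u (deriv g) hg' r b) x) r := by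
      intro r _
      change HasDerivAt (fun r => p x * g (r * u x + b)) ((p x * u x) * deriv g (r * u x + b)) r
      have h3 : HasDerivAt (fun r : ℝ => r * u x + b) (u x) r := by
        simpa using ((hasDerivAt_id r).mul_const (u x)).add_const b
      have := (((hd (r * u x + b)).hasDerivAt).comp r h3).const_mul (p x)
      exact this.congr_deriv (by ring)
    rw [intervalIntegral.integral_eq_sub_of_hasDerivAt h2]
    · exact (add_sub_cancel _ _).symm
    · apply Continuous.intervalIntegrable
      exact (ContinuousMap.evalCLM ℝ x).continuous.comp hcont
  have hD : HasDerivAt (fun s => rid p u g hg s b) (rid (p * u) u (deriv g) hg' l b) l := by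
    have h4 : HasDerivAt (fun s => ∫ r in (0 : ℝ)..s, rid (p * u) u (deriv g) hg' r b)
        (rid (p * u) u (deriv g) hg' l b) l :=
      intervalIntegral.integral_hasDerivAt_right (hcont.intervalIntegrable 0 l)
        (hcont.stronglyMeasurableAtFilter _ _) hcont.continuousAt
    have h5 := h4.const_add (rid p u g hg 0 b)
    have h6 : (fun s => rid p u g hg s b) = fun s => rid p u g hg 0 b +
      ∫ r in (0 : ℝ)..s, rid (p * u) u (deriv g) hg' r b := funext hint
    rw [h6]
    exact h5
  refine hS.mem_of_tendsto (hasDerivAt_iff_tendsto_slope.1 hD) (Eventually.of_forall fun s => ?_)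
  exact S.smul_mem _ (S.sub_mem (h s b) (h l b))

lemma iter_mem (S : Submodule ℝ C(X, ℝ)) (hS : IsClosed (S : Set C(X, ℝ)))
    (u : C(X, ℝ)) (k : ℕ) : ∀ (p : C(X, ℝ)) (g : ℝ → ℝ) (hg : ContDiff ℝ (⊤ : ℕ∞) g),
    (∀ l b, rid p u g hg.continuous l b ∈ S) → ∀ b,
    (iteratedDeriv k g b) • (p * u ^ k) ∈ S := by
  induction k with
  | zero =>
    intro p g hg h b
    convert h 0 b using 1
    ext x
    simp [rid, mul_comm]
  | succ k ih =>
    intro p g hg h b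
    have hg' : ContDiff ℝ (⊤ : ℕ∞) (deriv g) := (contDiff_infty_iff_deriv.1 hg).2
    have hd : Differentiable ℝ g := (contDiff_infty_iff_deriv.1 hg).1
    have := ih (p * u) (deriv g) hg'
      (fun l b => deriv_mem S hS p u g hg.continuous hd hg'.continuous h l b) b
    rw [iteratedDeriv_succ', pow_succ']
    rwa [mul_assoc] at this

lemma integral_mem' {E : Type*} [NormedAddCommGroup E] [NormedSpace ℝ E] [CompleteSpace E]
    (S : Submodule ℝ E) (hS : IsClosed (S : Set E)) (F : ℝ → E) (hF : ∀ s, F s ∈ S) :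
    ∫ s, F s ∈ S := by
  have : CompleteSpace S := hS.completeSpace_coe
  have h2 : ∫ s, F s = S.subtypeₗᵢ (∫ s, (⟨F s, hF s⟩ : S)) :=
    S.subtypeₗᵢ.integral_comp_comm (μ := volume) (fun s : ℝ => (⟨F s, hF s⟩ : S))
  rw [h2]
  exact Subtype.property _

lemma moll_mem (S : Submodule ℝ C(X, ℝ)) (hS : IsClosed (S : Set C(X, ℝ)))
    (u : C(X, ℝ)) (σ : ℝ → ℝ) (hσ : Continuous σ) (h : ∀ l b, rid 1 u σ hσ l b ∈ S)
    (φ : ℝ → ℝ) (hφ : Continuous φ) (hφc : HasCompactSupport φ) (g : ℝ → ℝ) (hg : Continuous g)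
    (hgφ : ∀ t, g t = ∫ s, φ s * σ (t - s)) (l b : ℝ) : rid 1 u g hg l b ∈ S := by
  have hcont : Continuous (fun s : ℝ => φ s • rid 1 u σ hσ l (b - s)) :=
    hφ.smul ((continuous_rid 1 u σ hσ).comp (by fun_prop : Continuous fun s : ℝ => (l, b - s)))
  have hcs : HasCompactSupport (fun s : ℝ => φ s • rid 1 u σ hσ l (b - s)) := hφc.smul_right
  have hi : Integrable (fun s : ℝ => φ s • rid 1 u σ hσ l (b - s)) :=
    hcont.integrable_of_hasCompactSupport hcs
  have heq : rid 1 u g hg l b = ∫ s, φ s • rid 1 u σ hσ l (b - s) := by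
    ext x
    have h1 : (∫ s, φ s • rid 1 u σ hσ l (b - s)) x = ∫ s, (φ s • rid 1 u σ hσ l (b - s)) x :=
      ((ContinuousMap.evalCLM ℝ x).integral_comp_comm hi).symm
    rw [h1]
    simp only [rid, ContinuousMap.coe_mk, ContinuousMap.one_apply, one_mul,
      ContinuousMap.smul_apply, smul_eq_mul, hgφ, add_sub_assoc]
  rw [heq]
  exact integral_mem' S hS _ fun s => S.smul_mem _ (h _ _)

lemma pow_mem (S : Submodule ℝ C(X, ℝ)) (hS : IsClosed (S : Set C(X, ℝ)))
    (u : C(X, ℝ)) (σ : ℝ → ℝ) (hσ : Continuous σ)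
    (hp : ¬ ∃ p : Polynomial ℝ, ∀ t : ℝ, σ t = p.eval t)
    (h : ∀ l b, rid 1 u σ hσ l b ∈ S) (k : ℕ) : u ^ k ∈ S := by
  by_contra hk
  apply hp
  let φ : ℕ → ContDiffBump (0 : ℝ) := fun i =>
    ⟨1 / ((i : ℝ) + 1) / 2, 1 / ((i : ℝ) + 1), by positivity, half_lt_self (by positivity)⟩
  have hφ : Tendsto (fun i => (φ i).rOut) atTop (𝓝 0) := tendsto_one_div_add_atTop_nhds_zero_nat
  let g : ℕ → ℝ → ℝ := fun i =>
    convolution ((φ i).normed volume) σ (ContinuousLinearMap.lsmul ℝ ℝ) volume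
  refine poly_of_limit k g σ (fun i => ?_) (fun t =>
    ContDiffBump.convolution_tendsto_right_of_continuous hφ hσ t)
  have hg : ContDiff ℝ (⊤ : ℕ∞) (g i) :=
    (φ i).hasCompactSupport_normed.contDiff_convolution_left _ (φ i).contDiff_normed
      hσ.locallyIntegrable
  refine poly_of_iteratedDeriv k (g i) hg fun t => ?_
  by_contra ht
  apply hk
  have := iter_mem S hS u k 1 (g i) hg (fun l b => moll_mem S hS u σ hσ h _
    (φ i).continuous_normed (φ i).hasCompactSupport_normed (g i) hg.continuous
    (fun t => rfl) l b) t
  rw [one_mul] at this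
  exact (S.smul_mem_iff ht).1 this

lemma exp_mem (S : Submodule ℝ C(X, ℝ)) (hS : IsClosed (S : Set C(X, ℝ)))
    (u : C(X, ℝ)) (h : ∀ k, u ^ k ∈ S) : NormedSpace.exp u ∈ S := by
  have := NormedSpace.exp_series_hasSum_exp' (𝕂 := ℝ) u
  exact hS.mem_of_tendsto this (Eventually.of_forall fun s =>
    S.sum_mem fun i _ => S.smul_mem _ (h i))

lemma top_of_exp (S : Submodule ℝ C(X, ℝ)) (hS : IsClosed (S : Set C(X, ℝ)))
    (U : Submodule ℝ C(X, ℝ)) (hU : ∀ x y : X, x ≠ y → ∃ u ∈ U, u x ≠ u y)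
    (h : ∀ u ∈ U, NormedSpace.exp u ∈ S) (f : C(X, ℝ)) : f ∈ S := by
  let M : Submonoid C(X, ℝ) :=
    { carrier := {v | ∃ u ∈ U, v = NormedSpace.exp u}
      one_mem' := ⟨0, U.zero_mem, NormedSpace.exp_zero.symm⟩
      mul_mem' := by
        rintro _ _ ⟨u, hu, rfl⟩ ⟨v, hv, rfl⟩
        exact ⟨u + v, U.add_mem hu hv, NormedSpace.exp_add.symm⟩ }
  let A : Subalgebra ℝ C(X, ℝ) := Algebra.adjoin ℝ (M : Set C(X, ℝ))
  have hA : A.SeparatesPoints := by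
    intro x y hxy
    obtain ⟨u, hu, huxy⟩ := hU x y hxy
    refine ⟨_, ⟨NormedSpace.exp u, Algebra.subset_adjoin ⟨u, hu, rfl⟩, rfl⟩, ?_⟩
    have he : ∀ z, (NormedSpace.exp u) z = Real.exp (u z) := by
      intro z
      rw [Real.exp_eq_exp_ℝ]
      exact NormedSpace.map_exp (ContinuousMap.evalAlgHom ℝ ℝ z)
        (ContinuousMap.evalCLM ℝ z).continuous u
    simp only [he]
    exact fun h => huxy (Real.exp_injective h)
  have htop := ContinuousMap.subalgebra_topologicalClosure_eq_top_of_separatesPoints A hA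
  have hAS : (A : Set C(X, ℝ)) ⊆ S := by
    intro a ha
    have ha' : a ∈ Subalgebra.toSubmodule A := ha
    rw [Algebra.adjoin_eq_span, Submonoid.closure_eq] at ha'
    refine Submodule.span_le.2 ?_ ha'
    rintro _ ⟨u, hu, rfl⟩
    exact h u hu
  have hf : f ∈ A.topologicalClosure := by rw [htop]; trivial
  exact closure_minimal hAS hS hf

end

/-- The linear functional `x ↦ ∑ w j * x j` restricted to `K`. -/
noncomputable def lin {n : ℕ} (K : Set (EuclideanSpace ℝ (Fin n))) : (Fin n → ℝ) →ₗ[ℝ] C(K, ℝ) where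
  toFun w := ⟨fun x => ∑ j, w j * x.1 j, by fun_prop⟩
  map_add' w v := by ext x; simp [add_mul, Finset.sum_add_distrib]
  map_smul' c w := by ext x; simp [Finset.mul_sum, mul_assoc]

lemma scalar_approx {n : ℕ} (K : Set (EuclideanSpace ℝ (Fin n))) (hK : IsCompact K)
    (σ : ℝ → ℝ) (hσ : Continuous σ)
    (hp : ¬ ∃ p : Polynomial ℝ, ∀ t : ℝ, σ t = p.eval t) (f : C(K, ℝ)) (δ : ℝ) (hδ : 0 < δ) :
    ∃ (k : ℕ) (c : Fin k → ℝ) (w : Fin k → Fin n → ℝ) (b : Fin k → ℝ),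
      ∀ x : K, |f x - ∑ i, c i * σ (∑ j, w i j * x.1 j + b i)| < δ := by
  have : CompactSpace K := isCompact_iff_compactSpace.1 hK
  let G : (Fin n → ℝ) × ℝ → C(K, ℝ) := fun q =>
    ⟨fun x => σ (∑ j, q.1 j * x.1 j + q.2), by fun_prop⟩
  let T : Submodule ℝ C(K, ℝ) := Submodule.span ℝ (Set.range G)
  have hf : f ∈ T.topologicalClosure := by
    refine top_of_exp _ T.isClosed_topologicalClosure (LinearMap.range (lin K)) ?_ ?_ f
    · intro x y hxy
      by_contra! hcon
      apply hxy
      ext j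
      have := hcon _ ⟨Pi.single j 1, rfl⟩
      simpa [lin, Pi.single_apply] using this
    · rintro _ ⟨w, rfl⟩
      refine exp_mem _ T.isClosed_topologicalClosure _ fun k => ?_
      refine pow_mem _ T.isClosed_topologicalClosure _ σ hσ hp (fun l b => ?_) k
      refine T.le_topologicalClosure (Submodule.subset_span ⟨(l • w, b), ?_⟩)
      ext x
      simp [G, rid, lin, Finset.mul_sum, mul_assoc]
  obtain ⟨a, haT, ha⟩ := Metric.mem_closure_iff.1 hf δ hδ
  obtain ⟨c, rfl⟩ := (Finsupp.mem_span_range_iff_exists_finsupp).1 haT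
  let e := c.support.equivFin
  refine ⟨c.support.card, fun i => c (e.symm i), fun i => (e.symm i).1.1,
    fun i => (e.symm i).1.2, fun x => ?_⟩
  have h1 := (ContinuousMap.dist_apply_le_dist x).trans_lt ha
  rw [Real.dist_eq] at h1
  have h2 : (c.sum fun i a => a • G i) x = ∑ i ∈ c.support, c i * G i x := by
    simp [Finsupp.sum, ContinuousMap.sum_apply]
  rw [h2, ← Finset.sum_coe_sort c.support, ← e.symm.sum_comp] at h1
  exact h1

end UAT

/-- **Universal Approximation Theorem (arbitrary width, single hidden layer;
Cybenko 1989, Hornik 1991).**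
Let `K ⊆ ℝⁿ` be compact and `σ : ℝ → ℝ` continuous and not a polynomial. Then for
every continuous `f : K → ℝᵐ` and every `ε > 0` there exist a hidden width `k`,
a matrix `W ∈ ℝ^{k×n}`, a bias vector `b ∈ ℝᵏ` and a matrix `C ∈ ℝ^{m×k}` such that
`sup_{x ∈ K} ‖f x - C ⬝ σ(W x + b)‖ < ε`, where `σ` acts entrywise and the norm on
`ℝᵐ` is the Euclidean norm. -/
theorem universal_approximation_shallow
    (n m : ℕ) (K : Set (EuclideanSpace ℝ (Fin n))) (hK : IsCompact K)
    (σ : ℝ → ℝ) (hσ_cont : Continuous σ)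
    (hσ_not_poly : ¬ ∃ p : Polynomial ℝ, ∀ t : ℝ, σ t = p.eval t)
    (f : EuclideanSpace ℝ (Fin n) → EuclideanSpace ℝ (Fin m))
    (hf : ContinuousOn f K)
    (ε : ℝ) (hε : 0 < ε) :
    ∃ (k : ℕ) (W : Matrix (Fin k) (Fin n) ℝ) (b : Fin k → ℝ)
      (C : Matrix (Fin m) (Fin k) ℝ),
      (⨆ x : K,
        ‖f x - (EuclideanSpace.equiv (Fin m) ℝ).symm
            (C.mulVec (fun i =>
              σ (W.mulVec (EuclideanSpace.equiv (Fin n) ℝ (x : EuclideanSpace ℝ (Fin n))) i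
                  + b i)))‖) < ε := by
  have : CompactSpace K := isCompact_iff_compactSpace.1 hK
  have hδ : 0 < ε / (2 * (m + 1)) := by positivity
  have hfc : Continuous (fun x : K => f x) := continuousOn_iff_continuous_domRestrict.1 hf
  have hfr : ∀ r : Fin m, Continuous (fun x : K => f x r) := fun r =>
    (EuclideanSpace.proj (𝕜 := ℝ) r).continuous.comp hfc
  have key := fun r : Fin m => UAT.scalar_approx K hK σ hσ_cont hσ_not_poly
    ⟨fun x : K => f x r, hfr r⟩ (ε / (2 * (m + 1))) hδ
  choose k c w b h using key
  let e := Fintype.equivFin (Σ r : Fin m, Fin (k r))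
  refine ⟨Fintype.card (Σ r : Fin m, Fin (k r)),
    Matrix.of fun i j => w (e.symm i).1 (e.symm i).2 j, fun i => b (e.symm i).1 (e.symm i).2,
    Matrix.of fun r i => if (e.symm i).1 = r then c (e.symm i).1 (e.symm i).2 else 0, ?_⟩
  refine lt_of_le_of_lt (Real.iSup_le (a := ε / 2) (fun x => ?_) (by positivity)) (by linarith)
  set v := f x - (EuclideanSpace.equiv (Fin m) ℝ).symm _ with hv
  have hvr : ∀ r, |v r| ≤ ε / (2 * (m + 1)) := by
    intro r
    refine le_of_eq_of_le ?_ (h r x).le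
    congr 1
    rw [hv, PiLp.sub_apply]
    congr 1
    change ∑ i, (if (e.symm i).1 = r then c (e.symm i).1 (e.symm i).2 else 0) *
      σ (∑ j, w (e.symm i).1 (e.symm i).2 j * x.1 j + b (e.symm i).1 (e.symm i).2) = _
    rw [e.symm.sum_comp (fun p => (if p.1 = r then c p.1 p.2 else 0) *
      σ (∑ j, w p.1 p.2 j * x.1 j + b p.1 p.2)), Fintype.sum_sigma]
    rw [Finset.sum_eq_single r]
    · simp
    · intro s _ hs
      simp [hs]
    · simp
  have hnorm : ‖v‖ ≤ ∑ r, |v r| := by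
    rw [EuclideanSpace.norm_eq]
    refine Real.sqrt_le_iff.2 ⟨Finset.sum_nonneg fun _ _ => abs_nonneg _, ?_⟩
    simp only [Real.norm_eq_abs]
    exact Finset.sum_sq_le_sq_sum_of_nonneg fun _ _ => abs_nonneg _
  calc ‖v‖ ≤ ∑ r, |v r| := hnorm
    _ ≤ ∑ _r : Fin m, ε / (2 * (m + 1)) := Finset.sum_le_sum fun r _ => hvr r
    _ = m * (ε / (2 * (m + 1))) := by simp
    _ ≤ (m + 1) * (ε / (2 * (m + 1))) := by gcongr; linarith
    _ = ε / 2 := by field_simp
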